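/- Let ρ satisfy condition (3) and 0 < t ≤ R. Then the manifold L^t, the image of K^t under (z,w) ↦ (z, w, I(z,w)) with Iⱼ(z,w) = (∂ρ/∂wⱼ(z,w)) / (Σₖ wₖ ∂ρ/∂wₖ(z,w)), is a totally real C⁵-smooth submanifold of ℂ^{2n+1}, i.e. it has no nonzero complex tangent vectors. -/

import Mathlib

open Complex Metric MeasureTheory Filter Set

noncomputable section

/-- The unit circle `Γ` in `ℂ`. -/
def Circ : Set ℂ := Metric.sphere (0 : ℂ) 1

/-- The closed unit disk `Δ` in `ℂ`. -/
def Disk : Set ℂ := Metric.closedBall (0 : ℂ) 1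

/-- The Euclidean norm on `ℂⁿ`. -/
def euclNorm {n : ℕ} (w : Fin n → ℂ) : ℝ := Real.sqrt (∑ j, Complex.normSq (w j))

/-- The complex partial derivative `∂g/∂wⱼ` of a real-valued function `g` on `ℂⁿ`. -/
def wderiv {n : ℕ} (g : (Fin n → ℂ) → ℝ) (w : Fin n → ℂ) (j : Fin n) : ℂ :=
  (((fderiv ℝ g w) (Pi.single j 1) : ℝ) - Complex.I * ((fderiv ℝ g w) (Pi.single j Complex.I) : ℝ)) / 2

/-- The affine complex tangent plane at `p` to the level set of `g` through `p`. -/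
def TangentPlane {n : ℕ} (g : (Fin n → ℂ) → ℝ) (p : Fin n → ℂ) : Set (Fin n → ℂ) :=
  {w | ∑ j, (w j - p j) * wderiv g p j = 0}

/-- `ρ` is strictly hypoconvex on a subset `U` of `Γ × ℂⁿ`: on every compact subset
there is `𝒦 > 0` such that the real Hessian in `w` is `≥ 𝒦‖u‖²` on complex tangent
vectors `u` of the fibers. -/
def StrictHypoconvexOn {n : ℕ} (ρ : ℂ → (Fin n → ℂ) → ℝ) (U : Set (ℂ × (Fin n → ℂ))) : Prop :=
  ∀ C : Set (ℂ × (Fin n → ℂ)), C ⊆ U → IsCompact C →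
    ∃ K0 > (0:ℝ), ∀ p ∈ C, ∀ u : Fin n → ℂ,
      (∑ j, u j * wderiv (ρ p.1) p.2 j) = 0 →
      K0 * (euclNorm u)^2 ≤ iteratedFDeriv ℝ 2 (ρ p.1) p.2 ![u, u]

/-- Two subsets of real normed spaces are (C⁶-)diffeomorphic: there are C⁶ maps on
open neighborhoods carrying one onto the other, inverse to each other on the sets. -/
def DiffeomorphicSets {E F : Type*} [NormedAddCommGroup E] [NormedSpace ℝ E]
    [NormedAddCommGroup F] [NormedSpace ℝ F] (A : Set E) (B : Set F) : Prop :=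
  ∃ (U : Set E) (V : Set F) (f : E → F) (g : F → E),
    IsOpen U ∧ IsOpen V ∧ A ⊆ U ∧ B ⊆ V ∧
    ContDiffOn ℝ 6 f U ∧ ContDiffOn ℝ 6 g V ∧
    Set.MapsTo f A B ∧ Set.MapsTo g B A ∧
    (∀ x ∈ A, g (f x) = x) ∧ (∀ y ∈ B, f (g y) = y)

/-- Condition (3) of the paper, for `ρ` with respect to `R` and `S`. -/
structure Cond3 (n : ℕ) (ρ : ℂ → (Fin n → ℂ) → ℝ) (R : ℝ) (S : ℂ → Fin n → ℂ) : Prop where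
  hn : 2 ≤ n
  nonneg : ∀ z ∈ Circ, ∀ w, 0 ≤ ρ z w
  cont : ContinuousOn (fun p : ℂ × (Fin n → ℂ) => ρ p.1 p.2) {p | p.1 ∈ Circ}
  smooth : ContDiffOn ℝ 6 (fun p : ℂ × (Fin n → ℂ) => ρ p.1 p.2)
      {p | p.1 ∈ Circ ∧ ρ p.1 p.2 ≠ 0}
  hR : 1 < R
  grad_ne : ∀ z ∈ Circ, ∀ w, 0 < ρ z w → ρ z w ≤ R → fderiv ℝ (ρ z) w ≠ 0
  hypo : StrictHypoconvexOn ρ {p | p.1 ∈ Circ ∧ ρ p.1 p.2 ≠ 0}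
  levelCompact : ∀ t : ℝ, 0 < t → t ≤ R →
      IsCompact {p : ℂ × (Fin n → ℂ) | p.1 ∈ Circ ∧ ρ p.1 p.2 = t}
  fiberSphere : ∀ t : ℝ, 0 < t → t ≤ R → ∀ z ∈ Circ,
      DiffeomorphicSets {w | ρ z w = t} (Metric.sphere (0 : EuclideanSpace ℂ (Fin n)) 1)
  levelR : ∀ z ∈ Circ, ∀ w, ρ z w = R ↔ euclNorm w = R
  aboveR : ∀ z ∈ Circ, ∀ w, R < euclNorm w → R < ρ z w
  Scont : ContinuousOn S Circ
  Ssmall : ∀ z ∈ Circ, euclNorm (S z) < R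
  Szero : ∀ z ∈ Circ, ∀ w, ρ z w = 0 ↔ w = S z

/-- The `j`-th Fourier coefficient of the boundary values of `f` on the circle. -/
def bCoeff (f : ℂ → ℂ) (j : ℤ) : ℂ :=
  (1 / (2 * Real.pi) : ℂ) * ∫ θ in (0:ℝ)..(2 * Real.pi),
    f (Complex.exp (↑θ * Complex.I)) * Complex.exp (-(j : ℂ) * ↑θ * Complex.I)

/-- The Hilbert space `ℓ²(ℤ)` used to represent `W^{1,2}(Γ)`. -/
abbrev Seq2 : Type := lp (fun _ : ℤ => ℂ) 2

/-- `a ∈ ℓ²(ℤ)` is the (weighted) Fourier coefficient representation of `f` in the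
Sobolev space `W^{1,2}(Γ)`; the weight `√(1+j²)` makes the `ℓ²` norm of `a`
equivalent to the `W^{1,2}` norm of `f`. -/
def RepOf (a : Seq2) (f : ℂ → ℂ) : Prop :=
  ∀ j : ℤ, (a : ∀ _ : ℤ, ℂ) j = (Real.sqrt (1 + (j:ℝ)^2) : ℂ) * bCoeff f j

/-- Membership in `H^{1,2}(Δ) = H²(Δ) ∩ W^{1,2}(Γ)` (whose elements extend
continuously to the closed disk). -/
def MemH12 (f : ℂ → ℂ) : Prop :=
  ContinuousOn f Disk ∧ DifferentiableOn ℂ f (Metric.ball (0:ℂ) 1) ∧ ∃ a : Seq2, RepOf a f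

/-- Membership in the disk algebra `A(Δ)`. -/
def MemA (f : ℂ → ℂ) : Prop :=
  ContinuousOn f Disk ∧ DifferentiableOn ℂ f (Metric.ball (0:ℂ) 1)

/-- Membership in `H^∞(Δ)`. -/
def MemHinf (f : ℂ → ℂ) : Prop :=
  DifferentiableOn ℂ f (Metric.ball (0:ℂ) 1) ∧ ∃ M : ℝ, ∀ z ∈ Metric.ball (0:ℂ) 1, ‖f z‖ ≤ M

/-- `f` is `C^k`-smooth on the circle `Γ`. -/
def CkCirc (k : ℕ) (f : ℂ → ℂ) : Prop :=
  ContDiff ℝ k (fun θ : ℝ => f (Complex.exp (↑θ * Complex.I)))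

/-- `f` is `C⁴`-smooth on the circle `Γ`. -/
def C4Circ (f : ℂ → ℂ) : Prop := CkCirc 4 f

/-- Vector-valued versions. -/
def MemH12V {n : ℕ} (f : ℂ → Fin n → ℂ) : Prop := ∀ j, MemH12 fun z => f z j
def MemAV {n : ℕ} (f : ℂ → Fin n → ℂ) : Prop := ∀ j, MemA fun z => f z j
def MemHinfV {n : ℕ} (f : ℂ → Fin n → ℂ) : Prop := ∀ j, MemHinf fun z => f z j
def C4CircV {n : ℕ} (f : ℂ → Fin n → ℂ) : Prop := ∀ j, C4Circ fun z => f z j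

/-- The coordinates of a point of `ℂ × ℂⁿ` as a point of `ℂ^{n+1}`. -/
def pcoords {n : ℕ} (p : ℂ × (Fin n → ℂ)) : Fin (n+1) → ℂ := Fin.cons p.1 p.2

/-- The polynomial hull of a subset of `ℂ × ℂⁿ ≅ ℂ^{n+1}`. -/
def polyHull {n : ℕ} (Y : Set (ℂ × (Fin n → ℂ))) : Set (ℂ × (Fin n → ℂ)) :=
  {p | ∀ P : MvPolynomial (Fin (n+1)) ℂ, ∀ M : ℝ,
    (∀ q ∈ Y, ‖MvPolynomial.eval (pcoords q) P‖ ≤ M) → ‖MvPolynomial.eval (pcoords p) P‖ ≤ M}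

/-- The polynomial hull of a subset of `ℂⁿ`. -/
def polyHulln {n : ℕ} (Y : Set (Fin n → ℂ)) : Set (Fin n → ℂ) :=
  {w | ∀ P : MvPolynomial (Fin n) ℂ, ∀ M : ℝ,
    (∀ v ∈ Y, ‖MvPolynomial.eval v P‖ ≤ M) → ‖MvPolynomial.eval w P‖ ≤ M}

/-- The coordinates of a point of `ℂ × ℂⁿ × ℂⁿ` as a point of `ℂ^{2n+1}`. -/
def pcoords2 {n : ℕ} (p : ℂ × ((Fin n → ℂ) × (Fin n → ℂ))) : Fin (n + n + 1) → ℂ :=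
  Fin.cons p.1 (Fin.append p.2.1 p.2.2)

/-- The polynomial hull of a subset of `ℂ × ℂⁿ × ℂⁿ ≅ ℂ^{2n+1}`. -/
def polyHull2 {n : ℕ} (Y : Set (ℂ × ((Fin n → ℂ) × (Fin n → ℂ)))) :
    Set (ℂ × ((Fin n → ℂ) × (Fin n → ℂ))) :=
  {p | ∀ P : MvPolynomial (Fin (n + n + 1)) ℂ, ∀ M : ℝ,
    (∀ q ∈ Y, ‖MvPolynomial.eval (pcoords2 q) P‖ ≤ M) → ‖MvPolynomial.eval (pcoords2 p) P‖ ≤ M}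

/-- A subset of `ℂⁿ` is hypoconvex if its complement is a union of complex affine
hyperplanes. -/
def HypoconvexSet {n : ℕ} (A : Set (Fin n → ℂ)) : Prop :=
  ∀ v : Fin n → ℂ, v ∉ A → ∃ (c : Fin n → ℂ) (d : ℂ), c ≠ 0 ∧
    (∑ j, c j * v j) = d ∧ ∀ w ∈ A, (∑ j, c j * w j) ≠ d

/-- `A` has `C^k` boundary: near each boundary point the boundary is the zero set of a
`C^k` function with nonvanishing gradient. -/
def CkBoundary {E : Type*} [NormedAddCommGroup E] [NormedSpace ℝ E] (k : ℕ) (A : Set E) : Prop :=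
  ∀ p ∈ frontier A, ∃ U : Set E, IsOpen U ∧ p ∈ U ∧
    ∃ φ : E → ℝ, ContDiffOn ℝ k φ U ∧ (∀ x ∈ U, fderiv ℝ φ x ≠ 0) ∧
      frontier A ∩ U = {x | φ x = 0} ∩ U

/-- `fb` gives the a.e. radial boundary values on `Γ` of the function `f` on the open disk. -/
def IsBdryVal {n : ℕ} (f fb : ℂ → Fin n → ℂ) : Prop :=
  ∀ᵐ (θ : ℝ) ∂(volume.restrict (Set.Ioc (0:ℝ) (2 * Real.pi))),
    Filter.Tendsto (fun r : ℝ => f ((r : ℂ) * Complex.exp (↑θ * Complex.I)))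
      (nhdsWithin 1 (Set.Iio 1)) (nhds (fb (Complex.exp (↑θ * Complex.I))))

/-- The optimal control `γ_ρ = inf_{f ∈ H^∞(Δ)ⁿ} ess sup_{z ∈ Γ} ρ(z,f(z))`. -/
def gammaRho {n : ℕ} (ρ : ℂ → (Fin n → ℂ) → ℝ) : ℝ :=
  sInf {c : ℝ | ∃ f fb : ℂ → Fin n → ℂ, MemHinfV f ∧ IsBdryVal f fb ∧
    ∀ᵐ (θ : ℝ) ∂(volume.restrict (Set.Ioc (0:ℝ) (2 * Real.pi))),
      ρ (Complex.exp (↑θ * Complex.I)) (fb (Complex.exp (↑θ * Complex.I))) ≤ c}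

/-- `δ_ρ = inf_{f ∈ A(Δ)ⁿ} sup_{z ∈ Γ} ρ(z,f(z))`. -/
def deltaRho {n : ℕ} (ρ : ℂ → (Fin n → ℂ) → ℝ) : ℝ :=
  sInf {c : ℝ | ∃ f : ℂ → Fin n → ℂ, MemAV f ∧ ∀ z ∈ Circ, ρ z (f z) ≤ c}

/-- `ρ_m(z,w) = ρ(z, w/zᵐ)`. -/
def rhoShift {n : ℕ} (ρ : ℂ → (Fin n → ℂ) → ℝ) (m : ℕ) : ℂ → (Fin n → ℂ) → ℝ :=
  fun z w => ρ z (fun j => w j / z ^ m)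

/-- `q` is an `n`-tuple of harmonic polynomials. -/
def HarmPolyTuple {n : ℕ} (q : ℂ → Fin n → ℂ) : Prop :=
  ∃ (d : ℕ) (a b : ℕ → Fin n → ℂ), ∀ z : ℂ, ∀ j,
    q z j = ∑ i ∈ Finset.range (d+1), (a i j * z ^ i + b i j * (starRingEnd ℂ z) ^ i)

/-- `zᵐ q(z)` has analytic polynomial coordinates (as boundary values on `Γ`). -/
def ZmAnalytic {n : ℕ} (m : ℕ) (q : ℂ → Fin n → ℂ) : Prop :=
  ∀ j, ∃ p : Polynomial ℂ, ∀ z ∈ Circ, z ^ m * q z j = Polynomial.eval z p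

/-- The boundary function `q` on `Γ` is analytic, i.e. agrees on `Γ` with an element
of `A(Δ)ⁿ`. -/
def BoundaryAnalytic {n : ℕ} (q : ℂ → Fin n → ℂ) : Prop :=
  ∃ h : ℂ → Fin n → ℂ, MemAV h ∧ ∀ z ∈ Circ, h z = q z


lemma aux_reg_nbhd {h : ℂ → ℝ} {h' : ℂ →L[ℝ] ℝ} {q : ℂ} (hf : HasStrictFDerivAt h h' q)
    (hne : h' ≠ 0) : ∃ N ∈ nhds q, IsPreconnected (N ∩ {x | h x < h q}) ∧
      N ∩ {x | h x ≤ h q} ⊆ closure (N ∩ {x | h x < h q}) := by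
  have hr : h'.range = ⊤ := by
    apply LinearMap.range_eq_top.2
    apply LinearMap.surjective
    intro h0
    apply hne
    ext x
    simpa using congrArg (fun f => f x) h0
  let Φ := hf.implicitToOpenPartialHomeomorph h h' hr
  have hΦ1 : ∀ x, (Φ x).1 = h x := fun x => hf.implicitToOpenPartialHomeomorph_fst hr x
  have hq : q ∈ Φ.source := hf.mem_implicitToOpenPartialHomeomorph_source hr
  have hΦq : Φ q ∈ Φ.target := Φ.map_source hq
  obtain ⟨ε, hε, hB⟩ := Metric.isOpen_iff.1 Φ.open_target _ hΦq
  set c := h q with hc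
  set k := (Φ q).2 with hk
  have hqq : Φ q = (c, k) := Prod.ext (hΦ1 q) rfl
  rw [hqq, ← ball_prod_same] at hB
  have hS : Φ.symm '' (ball c ε ×ˢ ball k ε) ∩ {x | h x < c}
      = Φ.symm '' ((ball c ε ∩ Iio c) ×ˢ ball k ε) := by
    ext x
    constructor
    · rintro ⟨⟨y, hy, rfl⟩, hx⟩
      refine ⟨y, ⟨⟨hy.1, ?_⟩, hy.2⟩, rfl⟩
      have := hΦ1 (Φ.symm y)
      rw [Φ.right_inv (hB hy)] at this
      simp only [mem_ofPred_eq] at hx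
      simp only [mem_Iio]
      linarith
    · rintro ⟨y, hy, rfl⟩
      refine ⟨⟨y, ⟨hy.1.1, hy.2⟩, rfl⟩, ?_⟩
      have := hΦ1 (Φ.symm y)
      rw [Φ.right_inv (hB ⟨hy.1.1, hy.2⟩)] at this
      have := hy.1.2
      simp only [mem_ofPred_eq]
      simp only [mem_Iio] at this
      linarith
  have hsub : (ball c ε ∩ Iio c) ×ˢ ball k ε ⊆ Φ.target := fun y hy => hB ⟨hy.1.1, hy.2⟩
  refine ⟨Φ.symm '' (ball c ε ×ˢ ball k ε), ?_, ?_, ?_⟩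
  · apply IsOpen.mem_nhds
    · exact Φ.symm.isOpen_image_of_subset_source (isOpen_ball.prod isOpen_ball) hB
    · exact ⟨Φ q, by rw [hqq]; exact ⟨mem_ball_self hε, mem_ball_self hε⟩, Φ.left_inv hq⟩
  · rw [hS]
    apply IsPreconnected.image
    · apply Convex.isPreconnected
      exact ((convex_ball _ _).inter (convex_Iio _)).prod (convex_ball _ _)
    · exact Φ.symm.continuousOn.mono hsub
  · rw [hS]
    rintro x ⟨⟨y, hy, rfl⟩, hx⟩
    have h1 := hΦ1 (Φ.symm y)
    rw [Φ.right_inv (hB hy)] at h1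
    simp only [mem_ofPred_eq] at hx
    have hcl : y ∈ closure ((ball c ε ∩ Iio c) ×ˢ ball k ε) := by
      rw [closure_prod_eq]
      refine ⟨?_, subset_closure hy.2⟩
      rw [Real.ball_eq_Ioo]
      have : Ioo (c-ε) (c+ε) ∩ Iio c = Ioo (c-ε) c := by
        ext z; simp; intros; linarith
      rw [this, closure_Ioo (by linarith)]
      have := hy.1
      rw [Real.ball_eq_Ioo] at this
      exact ⟨this.1.le, by linarith⟩
    have hct : ContinuousAt Φ.symm y := Φ.symm.continuousAt (hB hy)
    exact mem_closure_image hct hcl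

lemma aux_conn {ι : Type*} [Nonempty ι] (A : ι → Set ℂ) (hd : Directed (· ⊇ ·) A)
    (hc : ∀ i, IsCompact (A i)) (hp : ∀ i, IsPreconnected (A i)) :
    IsPreconnected (⋂ i, A i) := by
  have hcl : IsClosed (⋂ i, A i) := isClosed_iInter fun i => (hc i).isClosed
  rw [isPreconnected_iff_subset_of_fully_disjoint_closed hcl]
  intro u v hu hv huv hdis
  obtain ⟨U, V, hU, hV, huU, hvV, hUV⟩ := normal_separation hu hv hdis
  obtain ⟨i, hi⟩ := exists_subset_nhds_of_isCompact hd hc (U := U ∪ V) (by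
    intro x hx
    refine (hU.union hV).mem_nhds ?_
    rcases huv hx with h | h
    · exact Or.inl (huU h)
    · exact Or.inr (hvV h))
  have hsub : A i ⊆ U ∨ A i ⊆ V := by
    have := (isPreconnected_iff_subset_of_disjoint.1 (hp i)) U V hU hV hi (by
      rw [hUV.inter_eq, inter_empty])
    exact this
  rcases hsub with h | h
  · left
    intro x hx
    rcases huv hx with h' | h'
    · exact h'
    · exact (hUV.le_bot ⟨h (mem_iInter.1 hx i), hvV h'⟩).elim
  · right
    intro x hx
    rcases huv hx with h' | h'
    · exact (hUV.le_bot ⟨huU h', h (mem_iInter.1 hx i)⟩).elim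
    · exact h'

/-- isolated points of preconnected sets -/
lemma aux_isolated {A : Set ℂ} (hA : IsPreconnected A) {q b : ℂ} (hq : q ∈ A) (hb : b ∈ A)
    (hiso : ∀ᶠ x in nhdsWithin q {q}ᶜ, x ∉ A) : q = b := by
  by_contra hne
  rw [eventually_nhdsWithin_iff] at hiso
  obtain ⟨U, hU, hUo, hqU⟩ := _root_.eventually_nhds_iff.1 hiso
  obtain ⟨x, hx, hx1, hx2⟩ := hA U {q}ᶜ hUo isOpen_compl_singleton (by
    intro x hx
    by_cases h : x = q
    · exact Or.inl (h ▸ hqU)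
    · exact Or.inr h) ⟨q, hq, hqU⟩ ⟨b, hb, fun h => hne h.symm⟩
  exact hU x hx1 hx2 hx

lemma aux_closed {F : Set ℂ} (hF : IsClosed F) {x : ℂ} :
    closure (connectedComponentIn F x) ⊆ connectedComponentIn F x := by
  by_cases hx : x ∈ F
  · exact isPreconnected_connectedComponentIn.closure.subset_connectedComponentIn
      (subset_closure (mem_connectedComponentIn hx))
      (closure_minimal (connectedComponentIn_subset _ _) hF)
  · rw [connectedComponentIn_eq_empty hx]; simp

lemma aux_mountain {h : ℂ → ℝ} {R : ℝ} (hcont : Continuous h)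
    (hcpt : ∀ s < R, IsCompact {x | h x ≤ s})
    (hstar : ∀ x, h x < R → ∀ y ∈ segment ℝ 0 x, h y < R)
    (h0 : ∀ x, x ≠ 0 → h 0 < h x)
    (hcrit : ∀ x, x ≠ 0 → h x < R → (∃ h' : ℂ →L[ℝ] ℝ, h' ≠ 0 ∧ HasStrictFDerivAt h h' x) ∨
      (∀ᶠ y in nhdsWithin x {x}ᶜ, h x < h y))
    (a : ℂ) (ha0 : a ≠ 0) (haR : h a < R) (hmin : ∀ᶠ y in nhdsWithin a {a}ᶜ, h a < h y) :
    False := by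
  let P : ℝ → Prop := fun s => s < R ∧ ∃ C : Set ℂ, IsPreconnected C ∧ (0:ℂ) ∈ C ∧ a ∈ C ∧
    C ⊆ {x | h x ≤ s}
  -- compact connected subsets of open sublevels
  have key : ∀ s ≤ R, ∀ C : Set ℂ, IsCompact C → IsPreconnected C → 0 ∈ C → a ∈ C →
      C ⊆ {x | h x < s} → ∃ s' < s, P s' := by
    intro s hs C hC hCp hC0 hCa hCs
    obtain ⟨m, hm, hmax⟩ := hC.exists_isMaxOn ⟨0, hC0⟩ hcont.continuousOn
    refine ⟨h m, hCs hm, lt_of_lt_of_le (hCs hm) hs, C, hCp, hC0, hCa, fun x hx => hmax hx⟩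
  obtain ⟨s1, hs1R, hs1⟩ := key R le_rfl (segment ℝ 0 a)
    (by rw [segment_eq_image]; exact isCompact_Icc.image (by fun_prop))
    (convex_segment _ _).isPreconnected (left_mem_segment _ _ _) (right_mem_segment _ _ _)
    (fun y hy => hstar a haR y hy)
  have hbdd : BddBelow {s | P s} := ⟨h a, fun s hs => by
    obtain ⟨_, C, _, _, hCa, hC⟩ := hs
    exact hC hCa⟩
  set s := sInf {s | P s} with hsdef
  have hss1 : s ≤ s1 := csInf_le hbdd hs1
  have hsR : s < R := lt_of_le_of_lt hss1 hs1R
  have hPabove : ∀ r, s < r → r < R → a ∈ connectedComponentIn {x | h x ≤ r} 0 := by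
    intro r hr hrR
    obtain ⟨r', hr', hlt⟩ := exists_lt_of_csInf_lt ⟨s1, hs1⟩ hr
    obtain ⟨_, C, hCp, hC0, hCa, hC⟩ := hr'
    exact hCp.subset_connectedComponentIn hC0 (fun x hx => (hC hx).trans hlt.le) hCa
  have h0lt : h 0 < s := by
    have h1 : h a ≤ s := le_csInf ⟨s1, hs1⟩ fun s hs => by
      obtain ⟨_, C, _, _, hCa, hC⟩ := hs
      exact hC hCa
    exact lt_of_lt_of_le (h0 a ha0) h1
  -- the limit continuum
  let ι := {r : ℝ // s < r ∧ r < R}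
  have : Nonempty ι := ⟨⟨(s+R)/2, by constructor <;> linarith⟩⟩
  let A : ι → Set ℂ := fun r => connectedComponentIn {x | h x ≤ r.1} 0
  have hAc : ∀ i, IsCompact (A i) := fun i =>
    (hcpt i.1 i.2.2).of_isClosed_subset
      (isClosed_of_closure_subset (aux_closed (isClosed_le hcont continuous_const)))
      (connectedComponentIn_subset _ _)
  have hAmono : ∀ i j : ι, i.1 ≤ j.1 → A i ⊆ A j := fun i j hij =>
    connectedComponentIn_mono _ fun x hx => le_trans hx hij
  have hA0 : ∀ i, (0:ℂ) ∈ A i := fun i =>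
    mem_connectedComponentIn (by have := i.2.1; simp only [mem_ofPred_eq]; linarith)
  have hAa : ∀ i, a ∈ A i := fun i => hPabove _ i.2.1 i.2.2
  have hAd : Directed (· ⊇ ·) A := by
    intro i j
    rcases le_total i.1 j.1 with hij | hij
    · exact ⟨i, subset_rfl, hAmono _ _ hij⟩
    · exact ⟨j, hAmono _ _ hij, subset_rfl⟩
  have hDp : IsPreconnected (⋂ i, A i) := aux_conn A hAd hAc
    (fun i => isPreconnected_connectedComponentIn)
  set D := ⋂ i, A i with hD
  have hD0 : (0:ℂ) ∈ D := mem_iInter.2 hA0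
  have hDa : a ∈ D := mem_iInter.2 hAa
  have hDs : ∀ x ∈ D, h x ≤ s := by
    intro x hx
    apply le_of_forall_gt_imp_ge_of_dense
    intro r hr
    by_cases hrR : r < R
    · exact connectedComponentIn_subset {x | h x ≤ r} 0 (mem_iInter.1 hx ⟨r, hr, hrR⟩)
    · have : h x ≤ (s+R)/2 := connectedComponentIn_subset {x | h x ≤ (s+R)/2} 0
        (mem_iInter.1 hx ⟨(s+R)/2, by constructor <;> linarith⟩)
      linarith
  -- points of D at level s are not strict local minima
  have hnomin : ∀ q ∈ D, h q = s → ¬ (∀ᶠ y in nhdsWithin q {q}ᶜ, h q < h y) := by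
    intro q hq hqs hm
    have : q = 0 := aux_isolated hDp hq hD0 (hm.mono fun y hy hyD => by
      have := hDs y hyD
      linarith)
    subst this
    linarith
  have hreg : ∀ q ∈ D, h q = s → ∃ N ∈ nhds q, IsPreconnected (N ∩ {x | h x < s}) ∧
      N ∩ {x | h x ≤ s} ⊆ closure (N ∩ {x | h x < s}) := by
    intro q hq hqs
    have hq0 : q ≠ 0 := by rintro rfl; linarith
    rcases hcrit q hq0 (by linarith) with ⟨h', hne, hf⟩ | hm
    · have := aux_reg_nbhd hf hne
      rwa [hqs] at this
    · exact (hnomin q hq hqs hm).elim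
  have has : h a < s := lt_of_le_of_ne (hDs a hDa) fun he => hnomin a hDa he hmin
  have hVo : IsOpen {x | h x < s} := isOpen_lt hcont continuous_const
  set V := connectedComponentIn {x | h x < s} 0 with hV
  have hVopen : IsOpen V := hVo.connectedComponentIn
  have hVp : IsPreconnected V := isPreconnected_connectedComponentIn
  have h0V : (0:ℂ) ∈ V := mem_connectedComponentIn h0lt
  have hlow : ∀ q ∈ closure V, h q < s → q ∈ V := by
    intro q hq hqs
    have hU : IsOpen (connectedComponentIn {x | h x < s} q) := hVo.connectedComponentIn
    have hqU : q ∈ connectedComponentIn {x | h x < s} q := mem_connectedComponentIn hqs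
    obtain ⟨y, hy1, hy2⟩ := mem_closure_iff.1 hq _ hU hqU
    have e1 := connectedComponentIn_eq hy1
    have e2 := connectedComponentIn_eq hy2
    rw [hV, e2, ← e1]
    exact hqU
  -- relatively open
  have hopen : ∀ q ∈ D ∩ closure V, ∃ N ∈ nhds q, N ∩ D ⊆ closure V := by
    rintro q ⟨hqD, hqV⟩
    rcases lt_or_eq_of_le (hDs q hqD) with hlt | heq
    · exact ⟨V, hVopen.mem_nhds (hlow q hqV hlt), fun x hx => subset_closure hx.1⟩
    · obtain ⟨N, hN, hNp, hNc⟩ := hreg q hqD heq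
      refine ⟨N, hN, ?_⟩
      obtain ⟨y, hyN, hyV⟩ := mem_closure_iff_nhds.1 hqV N hN
      have hys : h y < s := connectedComponentIn_subset {x | h x < s} 0 hyV
      have hsub : N ∩ {x | h x < s} ⊆ V := by
        have := hNp.subset_connectedComponentIn (F := {x | h x < s}) ⟨hyN, hys⟩ inter_subset_right
        rw [hV, connectedComponentIn_eq hyV]
        exact this
      intro x hx
      exact closure_mono hsub (hNc ⟨hx.1, hDs x hx.2⟩)
  have haV : a ∈ closure V := by
    by_contra hna
    let W : Set ℂ := {x | ∃ N ∈ nhds x, N ∩ D ⊆ closure V}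
    have hW : IsOpen W := by
      rw [isOpen_iff_mem_nhds]
      rintro x ⟨N, hN, hND⟩
      filter_upwards [eventually_mem_nhds_iff.2 hN] with y hy
      exact ⟨N, hy, hND⟩
    obtain ⟨x, hxD, ⟨N, hN, hND⟩, hxV⟩ := hDp W (closure V)ᶜ hW isClosed_closure.isOpen_compl (by
      intro x hx
      by_cases h : x ∈ closure V
      · exact Or.inl (hopen x ⟨hx, h⟩)
      · exact Or.inr h) ⟨0, hD0, hopen 0 ⟨hD0, subset_closure h0V⟩⟩ ⟨a, hDa, hna⟩
    exact hxV (hND ⟨mem_of_mem_nhds hN, hxD⟩)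
  have haV' : a ∈ V := hlow a haV has
  have hpath : IsPathConnected V := hVopen.isConnected_iff_isPathConnected.1 ⟨⟨0, h0V⟩, hVp⟩
  obtain ⟨γ, hγ⟩ := hpath.joinedIn 0 h0V a haV'
  obtain ⟨s', hs', hP'⟩ := key s hsR.le (range γ) (isCompact_range γ.continuous)
    (isPreconnected_range γ.continuous) ⟨0, γ.source⟩ ⟨1, γ.target⟩ (by
      rintro _ ⟨x, rfl⟩
      exact connectedComponentIn_subset _ _ (hγ x))
  have := csInf_le hbdd hP'
  linarith

lemma aux_min {h : ℂ → ℝ} {x : ℂ} {H0 : ℂ →L[ℝ] ℂ →L[ℝ] ℝ}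
    (hd : ∀ᶠ y in nhds x, DifferentiableAt ℝ h y) (hH : HasFDerivAt (fderiv ℝ h) H0 x)
    (h0 : fderiv ℝ h x = 0) {K : ℝ} (hK0 : 0 < K) (hK : ∀ v, K * ‖v‖ ^ 2 ≤ H0 v v) :
    ∀ᶠ y in nhdsWithin x {x}ᶜ, h x < h y := by
  have h1 := hH.isLittleO.def (half_pos hK0)
  obtain ⟨δ, hδ, hball⟩ := Metric.eventually_nhds_iff_ball.1 (hd.and h1)
  rw [eventually_nhdsWithin_iff]
  filter_upwards [Metric.ball_mem_nhds x hδ] with y hy hyx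
  have hyx : y - x ≠ 0 := sub_ne_zero.2 hyx
  have hpos : 0 < ‖y - x‖ := norm_pos_iff.2 hyx
  have hmem : ∀ s ∈ Icc (0:ℝ) 1, x + s • (y - x) ∈ ball x δ := by
    intro s hs
    rw [mem_ball, dist_eq_norm] at hy ⊢
    rw [add_sub_cancel_left, norm_smul, Real.norm_eq_abs, abs_of_nonneg hs.1]
    nlinarith [hs.2]
  have hder : ∀ s ∈ Icc (0:ℝ) 1, HasDerivAt (fun s : ℝ => h (x + s • (y - x)))
      (fderiv ℝ h (x + s • (y - x)) (y - x)) s := by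
    intro s hs
    have e : HasDerivAt (fun s : ℝ => x + s • (y - x)) (y - x) s := by
      simpa using ((hasDerivAt_id s).smul_const (y - x)).const_add x
    exact (hball _ (hmem s hs)).1.hasFDerivAt.comp_hasDerivAt s e
  have hmono : StrictMonoOn (fun s : ℝ => h (x + s • (y - x))) (Icc 0 1) := by
    apply strictMonoOn_of_deriv_pos (convex_Icc _ _)
    · exact fun s hs => (hder s hs).continuousAt.continuousWithinAt
    · intro s hs
      rw [interior_Icc] at hs
      have hs' : s ∈ Icc (0:ℝ) 1 := Ioo_subset_Icc_self hs
      rw [(hder s hs').deriv]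
      have hb := (hball _ (hmem s hs')).2
      rw [h0, sub_zero, add_sub_cancel_left] at hb
      have h2 : |(fderiv ℝ h (x + s • (y - x)) - H0 (s • (y - x))) (y - x)|
          ≤ K / 2 * ‖s • (y - x)‖ * ‖y - x‖ := by
        rw [← Real.norm_eq_abs]
        exact (ContinuousLinearMap.le_opNorm _ _).trans (by gcongr)
      rw [norm_smul, Real.norm_eq_abs, abs_of_nonneg hs'.1] at h2
      have h3 := hK (y - x)
      have h4 := (abs_le.1 h2).1
      simp only [map_smul, _root_.sub_apply, _root_.smul_apply,
        smul_eq_mul] at h4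
      have h5 : s * (K * ‖y - x‖ ^ 2) ≤ s * (H0 (y - x)) (y - x) :=
        mul_le_mul_of_nonneg_left h3 hs'.1
      have h6 : 0 < s * (K / 2 * ‖y - x‖ ^ 2) := by have := hs.1; positivity
      nlinarith
  have := hmono (left_mem_Icc.2 zero_le_one) (right_mem_Icc.2 zero_le_one) zero_lt_one
  simpa using this

lemma aux_lin {n : ℕ} (L : (Fin n → ℂ) →L[ℝ] ℝ) (u : Fin n → ℂ) :
    ∑ j, u j * (((L (Pi.single j 1) : ℝ) - Complex.I * (L (Pi.single j Complex.I) : ℝ)) / 2)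
      = ((L u : ℝ) - Complex.I * (L (Complex.I • u) : ℝ)) / 2 := by
  have key : ∀ v : Fin n → ℂ, L v = ∑ j, ((v j).re * L (Pi.single j 1)
      + (v j).im * L (Pi.single j Complex.I)) := by
    intro v
    have hv : v = ∑ j, ((v j).re • (Pi.single j (1:ℂ) : Fin n → ℂ) + (v j).im • (Pi.single j Complex.I : Fin n → ℂ)) := by
      ext k
      simp [Finset.sum_apply, Pi.single_apply, Finset.sum_add_distrib]
    conv_lhs => rw [hv]
    simp
  rw [key u, key (Complex.I • u)]
  push_cast
  rw [Finset.mul_sum, ← Finset.sum_sub_distrib, Finset.sum_div]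
  apply Finset.sum_congr rfl
  intro j _
  conv_lhs => rw [← Complex.re_add_im (u j)]
  have hI : Complex.I * Complex.I = -1 := Complex.I_mul_I
  simp only [Pi.smul_apply, smul_eq_mul, Complex.mul_re, Complex.mul_im, Complex.I_re,
    Complex.I_im, zero_mul, one_mul, zero_sub, zero_add, Complex.ofReal_neg]
  linear_combination (-(u j).im * (L (Pi.single j Complex.I)) / 2 : ℂ) * hI

lemma aux_wsum {n : ℕ} (g : (Fin n → ℂ) → ℝ) (w u : Fin n → ℂ) :
    ∑ j, u j * wderiv g w j
      = ((fderiv ℝ g w u : ℝ) - Complex.I * (fderiv ℝ g w (Complex.I • u) : ℝ)) / 2 :=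
  aux_lin _ _

lemma aux_wsum_zero {n : ℕ} (g : (Fin n → ℂ) → ℝ) (w u : Fin n → ℂ) :
    ∑ j, u j * wderiv g w j = 0 ↔ fderiv ℝ g w u = 0 ∧ fderiv ℝ g w (Complex.I • u) = 0 := by
  rw [aux_wsum]
  constructor
  · intro h
    have h1 := congrArg Complex.re h
    have h2 := congrArg Complex.im h
    simp at h1 h2
    exact ⟨h1, h2⟩
  · rintro ⟨h1, h2⟩
    simp [h1, h2]

lemma euclNorm_smul {n : ℕ} (c : ℂ) (w : Fin n → ℂ) : euclNorm (c • w) = ‖c‖ * euclNorm w := by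
  unfold euclNorm
  simp only [Pi.smul_apply, smul_eq_mul, Complex.normSq_mul]
  rw [← Finset.mul_sum, Real.sqrt_mul (Complex.normSq_nonneg c)]
  rfl

lemma euclNorm_pos {n : ℕ} {w : Fin n → ℂ} (hw : w ≠ 0) : 0 < euclNorm w := by
  unfold euclNorm
  apply Real.sqrt_pos.2
  obtain ⟨j, hj⟩ := Function.ne_iff.1 hw
  exact Finset.sum_pos' (fun i _ => Complex.normSq_nonneg _) ⟨j, Finset.mem_univ _, Complex.normSq_pos.2 hj⟩

section cond
variable {n : ℕ} {ρ : ℂ → (Fin n → ℂ) → ℝ} {R : ℝ}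

lemma aux_ne (hρ : Cond3 n ρ R (fun _ => 0)) {z : ℂ} (hz : z ∈ Circ) {w : Fin n → ℂ}
    (hw : w ≠ 0) : ρ z w ≠ 0 := fun h => hw ((hρ.Szero z hz w).1 h)

lemma aux_zero (hρ : Cond3 n ρ R (fun _ => 0)) {z : ℂ} (hz : z ∈ Circ) : ρ z 0 = 0 :=
  (hρ.Szero z hz 0).2 rfl

lemma aux_slice_cont (hρ : Cond3 n ρ R (fun _ => 0)) {z : ℂ} (hz : z ∈ Circ) :
    Continuous (ρ z) := by
  rw [← continuousOn_univ]
  exact hρ.cont.comp (f := fun w => (z, w)) (by fun_prop) (fun w _ => hz)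

lemma aux_slice (hρ : Cond3 n ρ R (fun _ => 0)) {z : ℂ} (hz : z ∈ Circ) {w : Fin n → ℂ}
    (hw : w ≠ 0) : ContDiffAt ℝ 6 (ρ z) w := by
  have : ContDiffOn ℝ 6 (ρ z) {0}ᶜ :=
    hρ.smooth.comp (f := fun w => (z, w)) (by fun_prop) (fun w hw => ⟨hz, aux_ne hρ hz hw⟩)
  exact this.contDiffAt (isOpen_compl_singleton.mem_nhds hw)

lemma aux_lt_iff (hρ : Cond3 n ρ R (fun _ => 0)) {z : ℂ} (hz : z ∈ Circ) (w : Fin n → ℂ) :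
    ρ z w < R ↔ euclNorm w < R := by
  constructor
  · intro h
    by_contra hn
    rcases (not_lt.1 hn).lt_or_eq with h1 | h1
    · have := hρ.aboveR z hz w h1
      linarith
    · have := (hρ.levelR z hz w).2 h1.symm
      linarith
  · intro h
    by_contra hn
    have hc : ContinuousOn (fun s : ℝ => ρ z ((s:ℂ) • w)) (Icc 0 1) :=
      ((aux_slice_cont hρ hz).comp (by fun_prop)).continuousOn
    have := intermediate_value_Icc zero_le_one hc
    simp only [Complex.ofReal_zero, zero_smul, aux_zero hρ hz, Complex.ofReal_one, one_smul] at this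
    obtain ⟨s, hs, hsR⟩ := this ⟨by linarith [hρ.hR], not_lt.1 hn⟩
    have h2 := (hρ.levelR z hz _).1 hsR
    rw [euclNorm_smul, Complex.norm_real, Real.norm_eq_abs, abs_of_nonneg hs.1] at h2
    have : 0 ≤ euclNorm w := Real.sqrt_nonneg _
    nlinarith [hs.2]

lemma aux_den (hρ : Cond3 n ρ R (fun _ => 0)) {z : ℂ} (hz : z ∈ Circ) {w : Fin n → ℂ}
    (hw : w ≠ 0) (hwR : ρ z w ≤ R) : ∑ k, w k * wderiv (ρ z) w k ≠ 0 := by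
  intro hzero
  let ℓ : ℂ →L[ℝ] (Fin n → ℂ) := (ContinuousLinearMap.toSpanSingleton ℂ w).restrictScalars ℝ
  have hℓ : ∀ a, ℓ a = a • w := fun a => by simp [ℓ]
  have hℓ0 : ∀ a, a ≠ 0 → ℓ a ≠ 0 := fun a ha => by rw [hℓ]; exact smul_ne_zero ha hw
  set h : ℂ → ℝ := fun a => ρ z (ℓ a) with hh
  have hcont : Continuous h := (aux_slice_cont hρ hz).comp ℓ.continuous
  have hCD : ∀ a, a ≠ 0 → ContDiffAt ℝ 6 h a := fun a ha =>
    (aux_slice hρ hz (hℓ0 a ha)).comp a ℓ.contDiff.contDiffAt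
  have hfd : ∀ a, a ≠ 0 → fderiv ℝ h a = (fderiv ℝ (ρ z) (ℓ a)).comp ℓ := by
    intro a ha
    have h1 : HasFDerivAt (ρ z) (fderiv ℝ (ρ z) (ℓ a)) (ℓ a) :=
      ((aux_slice hρ hz (hℓ0 a ha)).differentiableAt (by norm_num)).hasFDerivAt
    exact (h1.comp a ℓ.hasFDerivAt).fderiv
  -- critical points are strict local minima
  have hmin : ∀ a, a ≠ 0 → fderiv ℝ h a = 0 → ∀ᶠ y in nhdsWithin a {a}ᶜ, h a < h y := by
    intro a ha hcr
    obtain ⟨K0, hK0, hK⟩ := hρ.hypo {(z, ℓ a)}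
      (by rintro _ rfl; exact ⟨hz, aux_ne hρ hz (hℓ0 a ha)⟩) isCompact_singleton
    have hF : HasFDerivAt (fderiv ℝ (ρ z)) (fderiv ℝ (fderiv ℝ (ρ z)) (ℓ a)) (ℓ a) :=
      (((aux_slice hρ hz (hℓ0 a ha)).fderiv_right (m := 5) (by norm_num)).differentiableAt
        (by norm_num)).hasFDerivAt
    have hF2 := (hF.comp a ℓ.hasFDerivAt).clm_comp (hasFDerivAt_const ℓ a)
    have hev : fderiv ℝ h =ᶠ[nhds a] fun y => (fderiv ℝ (ρ z) (ℓ y)).comp ℓ := by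
      filter_upwards [isOpen_compl_singleton.mem_nhds ha] with y hy
      exact hfd y hy
    have hF3 := hF2.congr_of_eventuallyEq hev
    refine aux_min ?_ hF3 hcr (K := K0 * euclNorm w ^ 2)
      (mul_pos hK0 (pow_pos (euclNorm_pos hw) 2)) ?_
    · filter_upwards [isOpen_compl_singleton.mem_nhds ha] with y hy
      exact (hCD y hy).differentiableAt (by norm_num)
    · intro v
      have h1 := hK (z, ℓ a) rfl (ℓ v) (by
        rw [aux_wsum_zero]
        have e : ∀ b, fderiv ℝ (ρ z) (ℓ a) (ℓ b) = 0 := fun b => by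
          have := congrArg (fun f => f b) ((hfd a ha).symm.trans hcr)
          simpa using this
        refine ⟨e v, ?_⟩
        have : Complex.I • ℓ v = ℓ (Complex.I * v) := by rw [hℓ, hℓ, mul_smul]
        rw [this]; exact e _)
      rw [iteratedFDeriv_two_apply] at h1
      simp only [Matrix.cons_val_zero, Matrix.cons_val_one] at h1
      rw [hℓ v, euclNorm_smul, ← hℓ v] at h1
      simp
      nlinarith
  have hcr1 : fderiv ℝ h 1 = 0 := by
    rw [hfd 1 one_ne_zero]
    have h1 : ℓ 1 = w := by rw [hℓ, one_smul]
    rw [aux_wsum_zero] at hzero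
    ext b
    rw [h1]
    have : ℓ b = b.re • w + b.im • (Complex.I • w) := by
      rw [hℓ]
      ext j
      simp only [Pi.smul_apply, Pi.add_apply, smul_eq_mul, Complex.real_smul]
      linear_combination (-(w j)) * (Complex.re_add_im b)
    simp [this, hzero.1, hzero.2]
  have hmin1 := hmin 1 one_ne_zero hcr1
  have hh1 : h 1 = ρ z w := by simp [hh, hℓ]
  have hen := euclNorm_pos hw
  have hlt : ∀ a, h a < R ↔ ‖a‖ * euclNorm w < R := fun a => by
    rw [hh]; simp only; rw [aux_lt_iff hρ hz, hℓ, euclNorm_smul]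
  have hstar : ∀ x, h x < R → ∀ y ∈ segment ℝ 0 x, h y < R := by
    intro x hx y hy
    rw [hlt] at hx ⊢
    rw [segment_eq_image] at hy
    obtain ⟨s, hs, rfl⟩ := hy
    simp only [smul_zero, zero_add, norm_smul, Real.norm_eq_abs, abs_of_nonneg hs.1]
    have : 0 ≤ ‖x‖ * euclNorm w := by positivity
    nlinarith [hs.2]
  rcases hwR.lt_or_eq with hwlt | hweq
  · refine aux_mountain (R := R) hcont ?_ hstar ?_ ?_ 1 one_ne_zero (by rw [hh1]; exact hwlt) hmin1
    · intro s hs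
      refine (isCompact_closedBall (0:ℂ) (R / euclNorm w)).of_isClosed_subset
        (isClosed_le hcont continuous_const) ?_
      intro x hx
      have hx' : h x < R := lt_of_le_of_lt hx hs
      rw [mem_closedBall_zero_iff, le_div_iff₀ hen]
      exact ((hlt x).1 hx').le
    · intro x hx
      have h1 : h 0 = 0 := by simp [hh, aux_zero hρ hz]
      rw [h1]
      exact lt_of_le_of_ne (hρ.nonneg z hz _) (aux_ne hρ hz (hℓ0 x hx)).symm
    · intro x hx _
      by_cases hc : fderiv ℝ h x = 0
      · exact Or.inr (hmin x hx hc)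
      · exact Or.inl ⟨_, hc, (hCD x hx).hasStrictFDerivAt (by norm_num)⟩
  · have hwe := (hρ.levelR z hz w).1 hweq
    rw [eventually_nhdsWithin_iff] at hmin1
    have ht : Tendsto (fun s : ℝ => (s : ℂ)) (nhdsWithin 1 (Iio 1)) (nhds 1) := by
      have : Continuous (fun s : ℝ => (s : ℂ)) := Complex.continuous_ofReal
      have := this.tendsto 1
      rw [Complex.ofReal_one] at this
      exact this.mono_left nhdsWithin_le_nhds
    have h3 := ht.eventually hmin1
    have h4 : ∀ᶠ s : ℝ in nhdsWithin 1 (Iio 1), 0 < s :=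
      nhdsWithin_le_nhds (lt_mem_nhds zero_lt_one)
    obtain ⟨s, hs1, hs2, hs3⟩ := (h3.and (h4.and self_mem_nhdsWithin)).exists
    have hs3 : s < 1 := hs3
    have h5 := hs1 (by
      simp only [mem_compl_iff, mem_singleton_iff]
      intro h
      have : s = 1 := by exact_mod_cast h
      linarith)
    rw [hh1, hweq] at h5
    have h6 : h s < R := by
      rw [hlt, hwe, Complex.norm_real, Real.norm_eq_abs, abs_of_pos hs2]
      nlinarith [hρ.hR]
    linarith

/-- radial projection to the circle -/
def auxProj (z : ℂ) : ℂ := (‖z‖⁻¹ : ℝ) • z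

lemma auxProj_mem {z : ℂ} (hz : z ≠ 0) : auxProj z ∈ Circ := by
  unfold auxProj Circ
  rw [mem_sphere_zero_iff_norm, norm_smul, norm_inv, norm_norm,
    inv_mul_cancel₀ (norm_ne_zero_iff.2 hz)]

lemma auxProj_eq {z : ℂ} (hz : z ∈ Circ) : auxProj z = z := by
  have : ‖z‖ = 1 := mem_sphere_zero_iff_norm.1 hz
  simp [auxProj, this]

lemma aux_circ_ne {z : ℂ} (hz : z ∈ Circ) : z ≠ 0 := by
  have : ‖z‖ = 1 := mem_sphere_zero_iff_norm.1 hz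
  rintro rfl
  simp at this

/-- the open set on which everything is smooth -/
def auxΩ (n : ℕ) : Set (ℂ × (Fin n → ℂ)) := {0}ᶜ ×ˢ {0}ᶜ

lemma auxΩ_open : IsOpen (auxΩ n) := isOpen_compl_singleton.prod isOpen_compl_singleton

lemma aux_F (hρ : Cond3 n ρ R (fun _ => 0)) :
    ContDiffOn ℝ 6 (fun p : ℂ × (Fin n → ℂ) => ρ (auxProj p.1) p.2) (auxΩ n) := by
  refine hρ.smooth.comp (f := fun p : ℂ × (Fin n → ℂ) => (auxProj p.1, p.2)) ?_ ?_
  · refine ContDiffOn.prodMk ?_ contDiff_snd.contDiffOn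
    intro p hp
    apply ContDiffAt.contDiffWithinAt
    have h1 : p.1 ≠ 0 := hp.1
    unfold auxProj
    refine ContDiffAt.smul (ContDiffAt.inv (contDiff_fst.contDiffAt.norm ℝ h1)
      (norm_ne_zero_iff.2 h1)) contDiff_fst.contDiffAt
  · intro p hp
    exact ⟨auxProj_mem hp.1, aux_ne hρ (auxProj_mem hp.1) hp.2⟩

lemma aux_fd (hρ : Cond3 n ρ R (fun _ => 0)) {p : ℂ × (Fin n → ℂ)} (hp : p ∈ auxΩ n) :
    fderiv ℝ (ρ (auxProj p.1)) p.2
      = (fderiv ℝ (fun p : ℂ × (Fin n → ℂ) => ρ (auxProj p.1) p.2) p).comp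
        (ContinuousLinearMap.inr ℝ ℂ (Fin n → ℂ)) := by
  have h1 := (((aux_F hρ).contDiffAt (auxΩ_open.mem_nhds hp)).differentiableAt
    (by norm_num)).hasFDerivAt
  have h2 : HasFDerivAt (fun w : Fin n → ℂ => (p.1, w))
      (ContinuousLinearMap.inr ℝ ℂ (Fin n → ℂ)) p.2 := hasFDerivAt_prodMk_right _ _
  exact (HasFDerivAt.comp (g := fun p : ℂ × (Fin n → ℂ) => ρ (auxProj p.1) p.2) p.2 h1 h2).fderiv

lemma aux_W (hρ : Cond3 n ρ R (fun _ => 0)) (j : Fin n) :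
    ContDiffOn ℝ 5 (fun p : ℂ × (Fin n → ℂ) => wderiv (ρ (auxProj p.1)) p.2 j) (auxΩ n) := by
  have h1 : ContDiffOn ℝ 5 (fun p : ℂ × (Fin n → ℂ) => fderiv ℝ (ρ (auxProj p.1)) p.2)
      (auxΩ n) := by
    have h2 := (aux_F hρ).fderiv_of_isOpen (m := 5) auxΩ_open (by norm_num)
    exact (h2.clm_comp contDiffOn_const).congr fun p hp => aux_fd hρ hp
  have h3 : ∀ e : Fin n → ℂ, ContDiffOn ℝ 5
      (fun p : ℂ × (Fin n → ℂ) => ((fderiv ℝ (ρ (auxProj p.1)) p.2 e : ℝ) : ℂ)) (auxΩ n) :=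
    fun e => Complex.ofRealCLM.contDiff.comp_contDiffOn (h1.clm_apply contDiffOn_const)
  unfold wderiv
  exact ((h3 _).sub (contDiffOn_const.mul (h3 _))).div_const 2

lemma aux_tan {E F : Type*} [NormedAddCommGroup E] [NormedSpace ℝ E] [NormedAddCommGroup F]
    [NormedSpace ℝ F] {φ : E → F} {φ' : E →L[ℝ] F} {s : Set E} {x v : E} {c : F}
    (h : HasFDerivAt φ φ' x) (hc : ∀ y ∈ s, φ y = c) (hv : v ∈ tangentConeAt ℝ s x) :
    φ' v = 0 := by
  have h1 := h.hasFDerivWithinAt.mapsTo_tangent_cone hv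
  refine tangentConeAt_subset_zero (fun hacc => ?_) h1
  have hsub : φ '' s ⊆ {c} := by rintro _ ⟨y, hy, rfl⟩; exact hc y hy
  have h2 := hacc.mono (Filter.principal_mono.2 hsub)
  rw [accPt_iff_frequently] at h2
  by_cases hx : φ x = c
  · obtain ⟨y, hy1, hy2⟩ := h2.exists
    exact hy1 ((mem_singleton_iff.1 hy2).trans hx.symm)
  · have : ∀ᶠ y in nhds (φ x), y ∈ ({c} : Set F)ᶜ := isOpen_compl_singleton.mem_nhds hx
    obtain ⟨y, ⟨_, hy2⟩, hy3⟩ := (h2.and_eventually this).exists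
    exact hy3 hy2

/-- the slice computation -/
lemma aux_slice_deriv (hρ : Cond3 n ρ R (fun _ => 0)) {z : ℂ} (hz : z ∈ Circ) {w : Fin n → ℂ}
    (hw : w ≠ 0) (J : (Fin n → ℂ) → Fin n → ℂ)
    (hJ : ∀ w, J w = fun j => wderiv (ρ z) w j / (∑ k, w k * wderiv (ρ z) w k))
    (hD : ∑ k, w k * wderiv (ρ z) w k ≠ 0)
    {A : (Fin n → ℂ) →L[ℝ] (Fin n → ℂ)} (hA : HasFDerivAt J A w)
    {u : Fin n → ℂ} (hu : ∑ j, u j * wderiv (ρ z) w j = 0) (x : Fin n → ℂ) :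
    (∑ j, u j * A x j) * (∑ k, w k * wderiv (ρ z) w k)
      = ((fderiv ℝ (fderiv ℝ (ρ z)) w x u : ℝ)
        - Complex.I * (fderiv ℝ (fderiv ℝ (ρ z)) w x (Complex.I • u) : ℝ)) / 2 := by
  set H := fderiv ℝ (fderiv ℝ (ρ z)) w with hH
  have hF : HasFDerivAt (fderiv ℝ (ρ z)) H w :=
    (((aux_slice hρ hz hw).fderiv_right (m := 5) (by norm_num)).differentiableAt
      (by norm_num)).hasFDerivAt
  have hl : HasDerivAt (fun s : ℝ => w + s • x) x 0 := by
    simpa using ((hasDerivAt_id (0:ℝ)).smul_const x).const_add w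
  have hw0 : w = w + (0:ℝ) • x := by simp
  have hF1 : HasDerivAt (fun s : ℝ => fderiv ℝ (ρ z) (w + s • x)) (H x) 0 := by
    rw [hw0] at hF
    exact hF.comp_hasDerivAt (0:ℝ) hl
  have hF2 : ∀ e : Fin n → ℂ, HasDerivAt
      (fun s : ℝ => ((fderiv ℝ (ρ z) (w + s • x) e : ℝ) : ℂ)) ((H x e : ℝ) : ℂ) 0 := by
    intro e
    have := hF1.clm_apply (hasDerivAt_const (0:ℝ) e)
    simp only [map_zero, add_zero] at this
    exact this.ofReal_comp
  have hW : ∀ j, HasDerivAt (fun s : ℝ => wderiv (ρ z) (w + s • x) j)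
      ((((H x) (Pi.single j 1) : ℝ) - Complex.I * ((H x) (Pi.single j Complex.I) : ℝ)) / 2) 0 :=
    fun j => ((hF2 _).sub ((hF2 _).const_mul Complex.I)).div_const 2
  have hlk : ∀ k, HasDerivAt (fun s : ℝ => (w + s • x) k) (x k) 0 :=
    fun k => hasDerivAt_pi.1 hl k
  have hDd := HasDerivAt.fun_sum (u := Finset.univ) fun k _ => (hlk k).mul (hW k)
  have hA1 : HasDerivAt (fun s : ℝ => J (w + s • x)) (A x) 0 := by
    rw [hw0] at hA
    exact hA.comp_hasDerivAt (0:ℝ) hl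
  have hS := HasDerivAt.fun_sum (u := Finset.univ)
    fun j _ => (hasDerivAt_pi.1 hA1 j).const_mul (u j)
  have hR := HasDerivAt.fun_sum (u := Finset.univ) fun j _ => (hW j).const_mul (u j)
  have hmul := hS.mul hDd
  have hev : (fun s : ℝ => ∑ j, u j * wderiv (ρ z) (w + s • x) j) =ᶠ[nhds 0]
      ((fun s : ℝ => ∑ j, u j * J (w + s • x) j) *
        (fun s : ℝ => ∑ k, ((fun s : ℝ => (w + s • x) k) *
          fun s : ℝ => wderiv (ρ z) (w + s • x) k) s)) := by
    have hne := hDd.continuousAt.eventually_ne (y := 0) (by simpa using hD)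
    filter_upwards [hne] with s hs
    simp only [Pi.mul_apply] at hs ⊢
    rw [Finset.sum_mul]
    apply Finset.sum_congr rfl
    intro j _
    rw [hJ]
    simp only
    rw [mul_assoc, div_mul_cancel₀ _ hs]
  have huniq := (hmul.congr_of_eventuallyEq hev).unique hR
  rw [aux_lin (H x) u] at huniq
  rw [← huniq]
  have hS0 : ∑ j, u j * J (w + (0:ℝ) • x) j = 0 := by
    rw [← hw0, hJ]
    simp only [mul_div_assoc']
    rw [← Finset.sum_div, hu, zero_div]
  rw [hS0]
  simp

end cond

/-- Lemma 1 (`L^t` is a totally real C⁵ manifold). -/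
theorem statement8 {n : ℕ} (ρ : ℂ → (Fin n → ℂ) → ℝ) (R : ℝ)
    (hρ : Cond3 n ρ R (fun _ => 0))
    (t : ℝ) (ht : 0 < t) (htR : t ≤ R)
    (Kt : Set (ℂ × (Fin n → ℂ)))
    (hKt : Kt = {p : ℂ × (Fin n → ℂ) | p.1 ∈ Circ ∧ ρ p.1 p.2 = t})
    (Ifun : ℂ × (Fin n → ℂ) → Fin n → ℂ)
    (hI : ∀ p : ℂ × (Fin n → ℂ), Ifun p =
      fun j => wderiv (ρ p.1) p.2 j / (∑ k, p.2 k * wderiv (ρ p.1) p.2 k))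
    (Lt : Set (ℂ × ((Fin n → ℂ) × (Fin n → ℂ))))
    (hLt : Lt = (fun p : ℂ × (Fin n → ℂ) => (p.1, (p.2, Ifun p))) '' Kt) :
    ContDiffOn ℝ 5 Ifun Kt ∧
    ∀ q ∈ Lt, ∀ v : ℂ × ((Fin n → ℂ) × (Fin n → ℂ)),
      v ∈ tangentConeAt ℝ Lt q → (Complex.I • v) ∈ tangentConeAt ℝ Lt q → v = 0 := by
  subst hKt
  have hKne : ∀ p : ℂ × (Fin n → ℂ), p.1 ∈ Circ → ρ p.1 p.2 = t → p.2 ≠ 0 := by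
    intro p hp1 hp2 h0
    rw [h0, aux_zero hρ hp1] at hp2
    linarith
  have hden : ∀ p : ℂ × (Fin n → ℂ), p.1 ∈ Circ → ρ p.1 p.2 = t →
      ∑ k, p.2 k * wderiv (ρ p.1) p.2 k ≠ 0 := fun p hp1 hp2 =>
    aux_den hρ hp1 (hKne p hp1 hp2) (by rw [hp2]; exact htR)
  -- smooth extension
  set G : ℂ × (Fin n → ℂ) → Fin n → ℂ := fun p => Ifun (auxProj p.1, p.2) with hG
  have hGI : ∀ p : ℂ × (Fin n → ℂ), p.1 ∈ Circ → G p = Ifun p := fun p hp => by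
    simp only [hG, auxProj_eq hp]
  have hGs : ∀ p : ℂ × (Fin n → ℂ), p.1 ∈ Circ → ρ p.1 p.2 = t → ContDiffAt ℝ 5 G p := by
    intro p hp1 hp2
    have hΩ : auxΩ n ∈ nhds p := auxΩ_open.mem_nhds ⟨aux_circ_ne hp1, hKne p hp1 hp2⟩
    have hW : ∀ j, ContDiffAt ℝ 5
        (fun p : ℂ × (Fin n → ℂ) => wderiv (ρ (auxProj p.1)) p.2 j) p :=
      fun j => (aux_W hρ j).contDiffAt hΩ
    rw [contDiffAt_pi]
    intro j
    simp only [hG, hI]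
    have hk : ∀ k, ContDiffAt ℝ 5
        (fun p : ℂ × (Fin n → ℂ) => p.2 k * wderiv (ρ (auxProj p.1)) p.2 k) p :=
      fun k => ContDiffAt.mul (by fun_prop) (hW k)
    have hsum : ContDiffAt ℝ 5
        (fun p : ℂ × (Fin n → ℂ) => ∑ k, p.2 k * wderiv (ρ (auxProj p.1)) p.2 k) p :=
      ContDiffAt.sum (fun k _ => hk k)
    have hne : (fun p : ℂ × (Fin n → ℂ) =>
        ∑ k, p.2 k * wderiv (ρ (auxProj p.1)) p.2 k) p ≠ 0 := by
      simp only [auxProj_eq hp1]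
      exact hden p hp1 hp2
    have hfin := ContDiffAt.mul (hW j) (ContDiffAt.inv hsum hne)
    simp only [div_eq_mul_inv]
    exact hfin
  refine ⟨?_, ?_⟩
  · intro p hp
    exact ((hGs p hp.1 hp.2).contDiffWithinAt).congr (fun y hy => (hGI y hy.1).symm)
      (hGI p hp.1).symm
  · subst hLt
    rintro _ ⟨⟨z, w⟩, ⟨hz, hzt⟩, rfl⟩ ⟨ζ, u, η⟩ hv hIv
    simp only at hz hzt hv hIv
    have hw : w ≠ 0 := hKne (z, w) hz hzt
    have hwΩ : (z, w) ∈ auxΩ n := ⟨aux_circ_ne hz, hw⟩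
    have hD := hden (z, w) hz hzt
    simp only at hD
    set L := (fun p : ℂ × (Fin n → ℂ) => (p.1, (p.2, Ifun p))) ''
      {p : ℂ × (Fin n → ℂ) | p.1 ∈ Circ ∧ ρ p.1 p.2 = t} with hL
    set q : ℂ × ((Fin n → ℂ) × (Fin n → ℂ)) := (z, (w, Ifun (z, w))) with hq
    -- the circle direction
    have hφ1 : HasFDerivAt (fun y : ℂ × ((Fin n → ℂ) × (Fin n → ℂ)) => ‖y.1‖ ^ 2)
        ((2 • (innerSL ℝ z)).comp (ContinuousLinearMap.fst ℝ ℂ _)) q :=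
      HasFDerivAt.comp (g := fun y : ℂ => ‖y‖ ^ 2) q
        (hasStrictFDerivAt_norm_sq z).hasFDerivAt hasFDerivAt_fst
    have hc1 : ∀ y ∈ L, ‖y.1‖ ^ 2 = 1 := by
      rintro _ ⟨p, hp, rfl⟩
      have : ‖p.1‖ = 1 := mem_sphere_zero_iff_norm.1 hp.1
      simp [this]
    have hζ : ζ = 0 := by
      have a1 := aux_tan hφ1 hc1 hv
      have a2 := aux_tan hφ1 hc1 hIv
      simp [Complex.inner] at a1 a2
      have hz1 : z.re * z.re + z.im * z.im ≠ 0 := by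
        have := Complex.normSq_pos.2 (aux_circ_ne hz)
        rw [Complex.normSq_apply] at this
        exact this.ne'
      apply Complex.ext
      · apply mul_left_cancel₀ hz1
        simp only [Complex.zero_re, Complex.zero_im, mul_zero]
        linear_combination (z.re / 2) * a1 + (z.im / 2) * a2
      · apply mul_left_cancel₀ hz1
        simp only [Complex.zero_re, Complex.zero_im, mul_zero]
        linear_combination (z.im / 2) * a1 - (z.re / 2) * a2
    subst hζ
    -- the projection to (z, w)
    have hπ : HasFDerivAt (fun y : ℂ × ((Fin n → ℂ) × (Fin n → ℂ)) => (y.1, y.2.1))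
        ((ContinuousLinearMap.fst ℝ ℂ ((Fin n → ℂ) × (Fin n → ℂ))).prod
          ((ContinuousLinearMap.fst ℝ (Fin n → ℂ) (Fin n → ℂ)).comp
            (ContinuousLinearMap.snd ℝ ℂ ((Fin n → ℂ) × (Fin n → ℂ))))) q :=
      hasFDerivAt_fst.prodMk (hasFDerivAt_fst.comp q hasFDerivAt_snd)
    have hFd := (((aux_F hρ).contDiffAt (auxΩ_open.mem_nhds hwΩ)).differentiableAt
      (by norm_num)).hasFDerivAt
    have hφ2 := HasFDerivAt.comp (g := fun p : ℂ × (Fin n → ℂ) => ρ (auxProj p.1) p.2) q hFd hπ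
    have hc2 : ∀ y ∈ L, ((fun p : ℂ × (Fin n → ℂ) => ρ (auxProj p.1) p.2) ∘
        (fun y : ℂ × ((Fin n → ℂ) × (Fin n → ℂ)) => (y.1, y.2.1))) y = t := by
      rintro _ ⟨p, hp, rfl⟩
      simp [auxProj_eq hp.1, hp.2]
    have hfd := aux_fd hρ hwΩ
    simp only [auxProj_eq hz] at hfd
    have b1 : fderiv ℝ (ρ z) w u = 0 := by
      rw [hfd]
      simpa using aux_tan hφ2 hc2 hv
    have b2 : fderiv ℝ (ρ z) w (Complex.I • u) = 0 := by
      rw [hfd]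
      simpa using aux_tan hφ2 hc2 hIv
    have hu : ∑ j, u j * wderiv (ρ z) w j = 0 := (aux_wsum_zero _ _ _).2 ⟨b1, b2⟩
    have hu' : ∑ j, (Complex.I • u) j * wderiv (ρ z) w j = 0 := by
      simp only [Pi.smul_apply, smul_eq_mul, mul_assoc]
      rw [← Finset.mul_sum, hu, mul_zero]
    -- the derivative of I
    have hGd := ((hGs (z, w) hz hzt).differentiableAt (by norm_num)).hasFDerivAt
    have hφ3 := (HasFDerivAt.comp (g := G) q hGd hπ).sub
      ((ContinuousLinearMap.snd ℝ (Fin n → ℂ) (Fin n → ℂ)).comp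
            (ContinuousLinearMap.snd ℝ ℂ ((Fin n → ℂ) × (Fin n → ℂ)))).hasFDerivAt
    have hc3 : ∀ y ∈ L, ((G ∘ (fun y : ℂ × ((Fin n → ℂ) × (Fin n → ℂ)) => (y.1, y.2.1))) -
        ⇑((ContinuousLinearMap.snd ℝ (Fin n → ℂ) (Fin n → ℂ)).comp
            (ContinuousLinearMap.snd ℝ ℂ ((Fin n → ℂ) × (Fin n → ℂ))))) y = 0 := by
      rintro _ ⟨p, hp, rfl⟩
      simp [hGI p hp.1]
    set A := (fderiv ℝ G (z, w)).comp (ContinuousLinearMap.inr ℝ ℂ (Fin n → ℂ)) with hA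
    have c1 : A u = η := by
      have := aux_tan hφ3 hc3 hv
      simpa [sub_eq_zero, hA] using this
    have c2 : A (Complex.I • u) = Complex.I • η := by
      have := aux_tan hφ3 hc3 hIv
      simpa [sub_eq_zero, hA] using this
    have hAd : HasFDerivAt (fun w => Ifun (z, w)) A w := by
      have h2 : HasFDerivAt (fun w : Fin n → ℂ => (z, w))
        (ContinuousLinearMap.inr ℝ ℂ (Fin n → ℂ)) w := hasFDerivAt_prodMk_right _ _
      have h3 := HasFDerivAt.comp (g := G) w hGd h2
      have h4 : (G ∘ fun w : Fin n → ℂ => (z, w)) = fun w => Ifun (z, w) := by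
        funext y
        exact hGI (z, y) hz
      rwa [h4] at h3
    have d := aux_slice_deriv hρ hz hw (fun w => Ifun (z, w)) (fun w => hI (z, w)) hD hAd hu
    have d1 := d u
    have d2 := d (Complex.I • u)
    rw [c1] at d1
    rw [c2] at d2
    have e1 : ∑ j, u j * (Complex.I • η) j = Complex.I * ∑ j, u j * η j := by
      rw [Finset.mul_sum]
      apply Finset.sum_congr rfl
      intro j _
      simp only [Pi.smul_apply, smul_eq_mul]
      ring
    rw [e1, mul_assoc, d1] at d2
    have d3 := congrArg Complex.im d2
    simp at d3
    obtain ⟨K0, hK0, hK⟩ := hρ.hypo {(z, w)}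
      (by rintro _ rfl; exact ⟨hz, aux_ne hρ hz hw⟩) isCompact_singleton
    have k1 := hK (z, w) rfl u hu
    have k2 := hK (z, w) rfl (Complex.I • u) hu'
    rw [iteratedFDeriv_two_apply] at k1 k2
    simp only [Matrix.cons_val_zero, Matrix.cons_val_one] at k1 k2
    rw [euclNorm_smul, Complex.norm_I, one_mul] at k2
    have hu0 : u = 0 := by
      by_contra hne
      have := mul_pos hK0 (pow_pos (euclNorm_pos hne) 2)
      linarith
    subst hu0
    have hη : η = 0 := by rw [← c1, map_zero]
    subst hη
    rfl
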